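/- arXiv:2201.07957 — 2 statements merged into one kernel-verified Lean document; each statement's English description precedes it below -/
import Mathlib

section
/- Let γ = 3 and λ ≥ 0. Suppose the initial data (τ₀,u₀) ∈ C¹(ℝ) satisfy ‖u₀‖_{C¹} ≤ C₀, ‖τ₀‖_{C¹} ≤ C₀ and C₀⁻¹ < τ₀(x) for all x, for some constant C₀ > 0, and let (τ,u) be a C¹ solution of the system on ℝ × [0,∞). Then ‖u‖_{L∞} is uniformly bounded for all time, and there exists a constant M̂ > 0 depending only on C₀, K, γ, λ and α such that the density ρ = τ⁻¹ satisfies ρ(x,t) ≥ C₀⁻¹ e^{−M̂ t} for all (x,t) ∈ ℝ × [0,∞); in particular, vacuum never occurs in finite time. -/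
open Real Set MeasureTheory

/-- Partial derivative in the space variable `x`. -/
noncomputable def pdx (f : ℝ → ℝ → ℝ) (x t : ℝ) : ℝ := deriv (fun y => f y t) x

/-- Partial derivative in the time variable `t`. -/
noncomputable def pdt (f : ℝ → ℝ → ℝ) (x t : ℝ) : ℝ := deriv (fun s => f x s) t

/-- `(τ, u)` is a `C¹` solution of the compressible Euler equations with
time-dependent damping `τ_t - u_x = 0`, `u_t + p_x = -(α/(1+t)^λ) u`,
`p = K τ^{-γ}`, on `ℝ × [0,∞)`. -/
def IsSol (K γ α lam : ℝ) (τ u : ℝ → ℝ → ℝ) : Prop :=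
  ContDiff ℝ 1 (fun p : ℝ × ℝ => τ p.1 p.2) ∧
  ContDiff ℝ 1 (fun p : ℝ × ℝ => u p.1 p.2) ∧
  (∀ x t, 0 ≤ t → 0 < τ x t) ∧
  (∀ x t, 0 ≤ t → pdt τ x t = pdx u x t) ∧
  (∀ x t, 0 ≤ t →
    pdt u x t + pdx (fun y s => K * τ y s ^ (-γ)) x t = -(α / (1 + t) ^ lam) * u x t)

/-- `φ = (2√(Kγ)/(γ-1)) τ^{-(γ-1)/2}`. -/
noncomputable def Phi (K γ : ℝ) (τ : ℝ → ℝ → ℝ) (x t : ℝ) : ℝ :=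
  (2 * Real.sqrt (K * γ) / (γ - 1)) * τ x t ^ (-(γ - 1) / 2)

/-- `K_τ = (2√(Kγ)/(γ-1))^{2/(γ-1)}`. -/
noncomputable def Ktau (K γ : ℝ) : ℝ := (2 * Real.sqrt (K * γ) / (γ - 1)) ^ (2 / (γ - 1))

/-- `K_c = √(Kγ) K_τ^{-(γ+1)/2}`. -/
noncomputable def Kc (K γ : ℝ) : ℝ := Real.sqrt (K * γ) * Ktau K γ ^ (-(γ + 1) / 2)

/-- Blow-up of `‖(τ_x, u_x)‖_{L^∞}` in finite time. -/
def BlowsUp (τ u : ℝ → ℝ → ℝ) : Prop :=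
  ∃ T > (0 : ℝ),
    ¬ BddAbove {r : ℝ | ∃ x t, 0 ≤ t ∧ t ≤ T ∧ r = |pdx τ x t| + |pdx u x t|}

open Filter Topology

theorem hasDerivAt_fderiv_along {f : ℝ → ℝ → ℝ} {X : ℝ → ℝ} {v t : ℝ}
    (hf : ContDiffAt ℝ 1 (fun p : ℝ × ℝ => f p.1 p.2) (X t, t)) (hX : HasDerivAt X v t) :
    HasDerivAt (fun s => f (X s) s)
      (fderiv ℝ (fun p : ℝ × ℝ => f p.1 p.2) (X t, t) (v, 1)) t :=
  (HasFDerivAt.comp_hasDerivAt (f := fun s => (X s, s)) t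
    (hf.differentiableAt one_ne_zero).hasFDerivAt (hX.prodMk (hasDerivAt_id' t)) :)

theorem hasDerivAt_pdx {f : ℝ → ℝ → ℝ} {x t : ℝ}
    (hf : ContDiffAt ℝ 1 (fun p : ℝ × ℝ => f p.1 p.2) (x, t)) :
    HasDerivAt (fun y => f y t) (pdx f x t) x :=
  DifferentiableAt.hasDerivAt
    (((hf.differentiableAt one_ne_zero).hasFDerivAt.comp_hasDerivAt x
      ((hasDerivAt_id x).prodMk (hasDerivAt_const x t)) :).differentiableAt)

theorem fderiv_eq_partials {f : ℝ → ℝ → ℝ} {x t : ℝ}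
    (hf : ContDiffAt ℝ 1 (fun p : ℝ × ℝ => f p.1 p.2) (x, t)) (v s : ℝ) :
    fderiv ℝ (fun p : ℝ × ℝ => f p.1 p.2) (x, t) (v, s) = v * pdx f x t + s * pdt f x t := by
  have hx : pdx f x t = fderiv ℝ (fun p : ℝ × ℝ => f p.1 p.2) (x, t) (1, 0) :=
    ((hf.differentiableAt one_ne_zero).hasFDerivAt.comp_hasDerivAt x
      ((hasDerivAt_id x).prodMk (hasDerivAt_const x t)) :).deriv
  have ht : pdt f x t = fderiv ℝ (fun p : ℝ × ℝ => f p.1 p.2) (x, t) (0, 1) :=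
    (hasDerivAt_fderiv_along (X := fun _ => x) hf (hasDerivAt_const t x)).deriv
  have : ((v, s) : ℝ × ℝ) = v • ((1, 0) : ℝ × ℝ) + s • ((0, 1) : ℝ × ℝ) := by simp
  rw [this, map_add, map_smul, map_smul, hx, ht, smul_eq_mul, smul_eq_mul]

theorem hasDerivAt_along {f : ℝ → ℝ → ℝ} {X : ℝ → ℝ} {v t : ℝ}
    (hf : ContDiffAt ℝ 1 (fun p : ℝ × ℝ => f p.1 p.2) (X t, t)) (hX : HasDerivAt X v t) :
    HasDerivAt (fun s => f (X s) s) (pdt f (X t) t + v * pdx f (X t) t) t := by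
  convert hasDerivAt_fderiv_along hf hX using 1
  rw [fderiv_eq_partials hf]; ring

theorem hasDerivAt_pdt {f : ℝ → ℝ → ℝ} {x t : ℝ}
    (hf : ContDiffAt ℝ 1 (fun p : ℝ × ℝ => f p.1 p.2) (x, t)) :
    HasDerivAt (fun s => f x s) (pdt f x t) t := by
  simpa using hasDerivAt_along (X := fun _ => x) hf (hasDerivAt_const t x)

theorem continuousAt_pdx {f : ℝ → ℝ → ℝ} {p : ℝ × ℝ}
    (hf : ContDiffAt ℝ 1 (fun p : ℝ × ℝ => f p.1 p.2) p) :
    ContinuousAt (fun p : ℝ × ℝ => pdx f p.1 p.2) p := by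
  have h := ((hf.fderiv_right (m := 0) (by norm_num)).continuousAt).clm_apply
    (continuousAt_const (y := ((1, 0) : ℝ × ℝ)))
  refine h.congr ?_
  filter_upwards [hf.eventually (by simp)] with q hq
  rw [fderiv_eq_partials (x := q.1) (t := q.2) hq]; simp

/-- A function that is nonpositive just before a zero has nonnegative derivative there. -/
theorem HasDerivAt.nonneg_of_left {g : ℝ → ℝ} {d t : ℝ} (hg : HasDerivAt g d t) (h0 : g t = 0)
    (hle : ∀ᶠ s in 𝓝[<] t, g s ≤ 0) : 0 ≤ d := by
  have h := (hasDerivAt_iff_tendsto_slope.1 hg).mono_left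
    (nhdsWithin_mono t (fun s hs => ne_of_lt (mem_Iio.1 hs) : Iio t ⊆ {t}ᶜ))
  refine ge_of_tendsto h ?_
  filter_upwards [hle, self_mem_nhdsWithin] with s hs hst
  rw [slope_def_field, h0, sub_zero]
  exact div_nonneg_of_nonpos hs (sub_nonpos.2 (le_of_lt hst))

/-- First touching principle on backward cones of slope `cs`. -/
theorem neg_of_no_first_touch {G : ℝ → ℝ → ℝ} {cs : ℝ} (hcs : 0 ≤ cs)
    (hG : ∀ x t, 0 ≤ t → ContinuousAt (fun p : ℝ × ℝ => G p.1 p.2) (x, t))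
    (h0 : ∀ x, G x 0 < 0)
    (htouch : ∀ x t, 0 < t → G x t = 0 →
      ¬ ∀ y s, 0 ≤ s → s < t → |y - x| ≤ cs * (t - s) → G y s < 0) :
    ∀ x t, 0 ≤ t → G x t < 0 := by
  intro x₁ t₁ ht₁
  by_contra! hpos
  let S : Set (ℝ × ℝ) := {p | 0 ≤ p.2 ∧ p.2 ≤ t₁ ∧ |p.1 - x₁| ≤ cs * (t₁ - p.2)}
  have hSclosed : IsClosed S := by
    refine (isClosed_le (f := fun _ => 0) continuous_const continuous_snd).inter
      ((isClosed_le (g := fun _ => t₁) continuous_snd continuous_const).inter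
        (isClosed_le (f := fun p : ℝ × ℝ => |p.1 - x₁|) (g := fun p => cs * (t₁ - p.2)) ?_ ?_)) <;>
      fun_prop
  have hSsub : S ⊆ Icc (x₁ - cs * t₁) (x₁ + cs * t₁) ×ˢ Icc 0 t₁ := by
    rintro ⟨y, s⟩ ⟨hs0, hs1, hy⟩
    simp only at hs0 hs1 hy
    have : cs * (t₁ - s) ≤ cs * t₁ := by gcongr; linarith
    have := abs_le.1 (hy.trans this)
    exact ⟨⟨by simp only; linarith, by simp only; linarith⟩, hs0, hs1⟩
  have hScomp : IsCompact S := (isCompact_Icc.prod isCompact_Icc).of_isClosed_subset hSclosed hSsub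
  have hGS : ContinuousOn (fun p : ℝ × ℝ => G p.1 p.2) S := fun p hp =>
    (hG p.1 p.2 hp.1).continuousWithinAt
  have hZcomp : IsCompact (S ∩ (fun p : ℝ × ℝ => G p.1 p.2) ⁻¹' Ici 0) :=
    hScomp.of_isClosed_subset (hGS.preimage_isClosed_of_isClosed hSclosed isClosed_Ici)
      inter_subset_left
  obtain ⟨⟨x, t⟩, ⟨⟨ht0, htt, hxt⟩, hGt⟩, hmin⟩ := hZcomp.exists_isMinOn
    ⟨(x₁, t₁), ⟨ht₁, le_rfl, by simp⟩, hpos⟩ (continuous_snd.continuousOn)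
  simp only [mem_preimage, mem_Ici] at ht0 htt hxt hGt
  have htpos : 0 < t := by
    rcases ht0.eq_or_lt with rfl | h
    · exact absurd hGt (not_le.2 (h0 x))
    · exact h
  have hbefore : ∀ y s, 0 ≤ s → s < t → |y - x| ≤ cs * (t - s) → G y s < 0 := by
    intro y s hs hst hy
    by_contra! hcon
    have hmem : ((y, s) : ℝ × ℝ) ∈ S := by
      refine ⟨hs, hst.le.trans htt, ?_⟩
      have := abs_sub_le y x x₁
      simp only
      nlinarith
    exact absurd (hmin ⟨hmem, hcon⟩) (not_le.2 hst)
  refine htouch x t htpos (le_antisymm ?_ hGt) hbefore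
  have hlim : Tendsto (fun s => G x s) (𝓝[<] t) (𝓝 (G x t)) :=
    ((hG x t ht0).comp (f := fun s : ℝ => ((x, s) : ℝ × ℝ)) (x := t)
      (by fun_prop)).tendsto.mono_left nhdsWithin_le_nhds
  refine le_of_tendsto hlim ?_
  filter_upwards [Ioo_mem_nhdsLT htpos] with s hs
  refine (hbefore x s hs.1.le hs.2 ?_).le
  simpa using mul_nonneg hcs (sub_nonneg.2 hs.2.le)
/-- Local existence of characteristics of a time-dependent `C¹` speed. -/
theorem exists_characteristic {c : ℝ → ℝ → ℝ} {x t : ℝ}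
    (hc : ContDiffAt ℝ 1 (fun p : ℝ × ℝ => c p.1 p.2) (x, t)) :
    ∃ X : ℝ → ℝ, X t = x ∧ ∀ᶠ s in 𝓝 t, HasDerivAt X (c (X s) s) s := by
  obtain ⟨β, hβt, ε, hε, hβ⟩ :=
    (hc.prodMk (contDiffAt_const (c := (1 : ℝ)))
      ).exists_forall_mem_closedBall_exists_eq_forall_mem_Ioo_hasDerivAt₀ t
  have hI : Ioo (t - ε) (t + ε) ∈ 𝓝 t := Ioo_mem_nhds (by linarith) (by linarith)
  have h₁ : ∀ s ∈ Ioo (t - ε) (t + ε),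
      HasDerivAt (fun s => (β s).1) (c (β s).1 (β s).2) s := fun s hs =>
    ((hasFDerivAt_fst (𝕜 := ℝ) (p := β s)).comp_hasDerivAt s (hβ s hs) :)
  have h₂ : ∀ s ∈ Ioo (t - ε) (t + ε), HasDerivAt (fun s => (β s).2) 1 s := fun s hs =>
    ((hasFDerivAt_snd (𝕜 := ℝ) (p := β s)).comp_hasDerivAt s (hβ s hs) :)
  have hsnd : ∀ s ∈ Ioo (t - ε) (t + ε), (β s).2 = s := by
    intro s hs
    have hd : ∀ r ∈ Ioo (t - ε) (t + ε),
        HasDerivWithinAt (fun r => (β r).2 - r) 0 (Ioo (t - ε) (t + ε)) r := fun r hr => by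
      have := ((h₂ r hr).sub (hasDerivAt_id r)).hasDerivWithinAt (s := Ioo (t - ε) (t + ε))
      rw [sub_self] at this
      exact this
    have := (convex_Ioo (t - ε) (t + ε)).norm_image_sub_le_of_norm_hasDerivWithin_le (C := 0) hd
      (by simp) (show t ∈ _ from ⟨by linarith, by linarith⟩) hs
    simp only [zero_mul, norm_le_zero_iff, hβt] at this
    linarith
  refine ⟨fun s => (β s).1, by simp [hβt], ?_⟩
  filter_upwards [hI] with s hs
  simpa [hsnd s hs] using h₁ s hs

/-- Remainder of the first-order expansion of a `C¹` function between the curve `X` and the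
neighbouring curve `X + h (1 + b (s - t))`. -/
theorem isLittleO_sub_neighbour {f : ℝ → ℝ → ℝ} {X : ℝ → ℝ} {t b : ℝ}
    (hf : ContDiffAt ℝ 1 (fun p : ℝ × ℝ => f p.1 p.2) (X t, t)) (hX : ContinuousAt X t) :
    (fun q : ℝ × ℝ => f (X q.2 + q.1 * (1 + b * (q.2 - t))) q.2 - f (X q.2) q.2
      - q.1 * pdx f (X t) t) =o[𝓝 ((0 : ℝ), t)] (fun q => q.1) := by
  have hX' : ContinuousAt (fun q : ℝ × ℝ => X q.2) (0, t) :=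
    ContinuousAt.comp (f := fun q : ℝ × ℝ => q.2) (x := (0, t)) hX continuousAt_snd
  have ht : Tendsto (fun q : ℝ × ℝ =>
      ((X q.2 + q.1 * (1 + b * (q.2 - t)), q.2), (X q.2, q.2))) (𝓝 ((0 : ℝ), t))
      (𝓝 ((X t, t), (X t, t))) := by
    have : ContinuousAt (fun q : ℝ × ℝ =>
      ((X q.2 + q.1 * (1 + b * (q.2 - t)), q.2), (X q.2, q.2))) ((0 : ℝ), t) := by fun_prop
    simpa [ContinuousAt] using this
  have hb : Tendsto (fun q : ℝ × ℝ => 1 + b * (q.2 - t)) (𝓝 ((0 : ℝ), t)) (𝓝 1) := by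
    have : ContinuousAt (fun q : ℝ × ℝ => 1 + b * (q.2 - t)) ((0 : ℝ), t) := by fun_prop
    simpa [ContinuousAt] using this
  have h := ((hf.hasStrictFDerivAt one_ne_zero).isLittleO).comp_tendsto ht
  have hO : (fun q : ℝ × ℝ => q.1 * (1 + b * (q.2 - t))) =O[𝓝 ((0 : ℝ), t)] (fun q => q.1) := by
    simpa using (Asymptotics.isBigO_refl (fun q : ℝ × ℝ => q.1) _).mul (hb.isBigO_one ℝ)
  have h₁ : (fun q : ℝ × ℝ => f (X q.2 + q.1 * (1 + b * (q.2 - t))) q.2 - f (X q.2) q.2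
      - q.1 * (1 + b * (q.2 - t)) * pdx f (X t) t) =o[𝓝 ((0 : ℝ), t)] (fun q => q.1) := by
    refine (h.congr_left fun q => ?_).trans_isBigO ?_
    · simp [fderiv_eq_partials hf]
    · refine Asymptotics.isBigO_norm_left.1 (hO.norm_left.congr_left fun q => ?_)
      simp [Prod.norm_def, mul_nonneg]
  have hb0 : Tendsto (fun q : ℝ × ℝ => b * (q.2 - t) * pdx f (X t) t) (𝓝 ((0 : ℝ), t)) (𝓝 0) := by
    have : ContinuousAt (fun q : ℝ × ℝ => b * (q.2 - t) * pdx f (X t) t) ((0 : ℝ), t) := by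
      fun_prop
    simpa [ContinuousAt] using this
  have h₂ := (Asymptotics.isBigO_refl (fun q : ℝ × ℝ => q.1) (𝓝 ((0 : ℝ), t))).mul_isLittleO
    ((Asymptotics.isLittleO_one_iff ℝ).2 hb0)
  simp only [mul_one] at h₂
  refine (h₁.add h₂).congr_left fun q => ?_
  ring

/-- The space derivative of a `C¹` solution of `w_t + c w_x = f` is differentiable along
characteristics, with `(w_x)' = f_x - c_x w_x`. -/
theorem hasDerivAt_pdx_along {w c f : ℝ → ℝ → ℝ} {X : ℝ → ℝ} {t : ℝ}
    (hw : ContDiffAt ℝ 1 (fun p : ℝ × ℝ => w p.1 p.2) (X t, t))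
    (hc : ContDiffAt ℝ 1 (fun p : ℝ × ℝ => c p.1 p.2) (X t, t))
    (hf : ContDiffAt ℝ 1 (fun p : ℝ × ℝ => f p.1 p.2) (X t, t))
    (heq : ∀ᶠ p : ℝ × ℝ in 𝓝 (X t, t),
      pdt w p.1 p.2 + c p.1 p.2 * pdx w p.1 p.2 = f p.1 p.2)
    (hX : ∀ᶠ s in 𝓝 t, HasDerivAt X (c (X s) s) s) :
    HasDerivAt (fun s => pdx w (X s) s) (pdx f (X t) t - pdx c (X t) t * pdx w (X t) t) t := by
  have hXc : ContinuousAt X t := hX.self_of_nhds.continuousAt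
  set b := pdx c (X t) t with hb
  set A := pdx f (X t) t with hA
  have hX' : ContinuousAt (fun q : ℝ × ℝ => X q.2) (0, t) :=
    ContinuousAt.comp (f := fun q : ℝ × ℝ => q.2) (x := (0, t)) hXc continuousAt_snd
  have hP : Tendsto (fun q : ℝ × ℝ => (X q.2 + q.1 * (1 + b * (q.2 - t)), q.2))
      (𝓝 ((0 : ℝ), t)) (𝓝 (X t, t)) := by
    have : ContinuousAt (fun q : ℝ × ℝ => (X q.2 + q.1 * (1 + b * (q.2 - t)), q.2))
      ((0 : ℝ), t) := by fun_prop
    simpa [ContinuousAt] using this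
  have hP0 : Tendsto (fun q : ℝ × ℝ => (X q.2, q.2)) (𝓝 ((0 : ℝ), t)) (𝓝 (X t, t)) := by
    have : ContinuousAt (fun q : ℝ × ℝ => (X q.2, q.2)) ((0 : ℝ), t) := by fun_prop
    simpa [ContinuousAt] using this
  have hwC := hw.eventually (by simp)
  -- the remainder in the evolution of the difference along neighbouring curves
  have hR : (fun q : ℝ × ℝ =>
      (f (X q.2 + q.1 * (1 + b * (q.2 - t))) q.2 - f (X q.2) q.2 - q.1 * A)
      + pdx w (X q.2 + q.1 * (1 + b * (q.2 - t))) q.2 *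
        (-(c (X q.2 + q.1 * (1 + b * (q.2 - t))) q.2 - c (X q.2) q.2 - q.1 * b)))
      =o[𝓝 ((0 : ℝ), t)] (fun q => q.1) := by
    refine (isLittleO_sub_neighbour hf hXc).add ?_
    have h₁ := (((continuousAt_pdx hw).tendsto.comp hP).isBigO_one ℝ).mul_isLittleO
      (isLittleO_sub_neighbour (b := b) hc hXc).neg_left
    simpa using h₁
  have hev : HasDerivAt (fun s => (1 + b * (s - t)) * pdx w (X s) s) A t := by
    rw [hasDerivAt_iff_isLittleO, Asymptotics.isLittleO_iff]
    intro ε hε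
    have hall : ∀ᶠ q : ℝ × ℝ in 𝓝 ((0 : ℝ), t),
        HasDerivAt (fun s => w (X s + q.1 * (1 + b * (s - t))) s - w (X s) s - q.1 * A * s)
          ((f (X q.2 + q.1 * (1 + b * (q.2 - t))) q.2 - f (X q.2) q.2 - q.1 * A)
          + pdx w (X q.2 + q.1 * (1 + b * (q.2 - t))) q.2 *
          (-(c (X q.2 + q.1 * (1 + b * (q.2 - t))) q.2 - c (X q.2) q.2 - q.1 * b))) q.2 ∧
        ContDiffAt ℝ 1 (fun p : ℝ × ℝ => w p.1 p.2)
          (X q.2, q.2) ∧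
        ‖(f (X q.2 + q.1 * (1 + b * (q.2 - t))) q.2 - f (X q.2) q.2 - q.1 * A)
          + pdx w (X q.2 + q.1 * (1 + b * (q.2 - t))) q.2 *
          (-(c (X q.2 + q.1 * (1 + b * (q.2 - t))) q.2 - c (X q.2) q.2 - q.1 * b))‖
          ≤ ε * ‖q.1‖ := by
      filter_upwards [hP.eventually hwC, hP0.eventually hwC, hP.eventually heq,
        hP0.eventually heq, continuousAt_snd.eventually hX, Asymptotics.isLittleO_iff.1 hR hε]
        with q h₁ h₂ h₃ h₄ h₅ h₆
      refine ⟨?_, h₂, h₆⟩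
      have hY : HasDerivAt (fun s => X s + q.1 * (1 + b * (s - t)))
          (c (X q.2) q.2 + q.1 * b) q.2 := by
        have := h₅.add (((((hasDerivAt_id q.2).sub_const t).const_mul b).const_add
          1).const_mul q.1)
        rw [mul_one] at this
        exact this
      have := ((hasDerivAt_along (f := w) h₁ hY).sub (hasDerivAt_along h₂ h₅)).sub
        ((hasDerivAt_id q.2).const_mul (q.1 * A))
      refine HasDerivAt.congr_deriv this ?_
      rw [← h₃, ← h₄]
      ring
    obtain ⟨η, hη, hball⟩ := Metric.eventually_nhds_iff_ball.1 hall
    filter_upwards [Metric.ball_mem_nhds t hη] with s hs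
    have hmem : ∀ h, |h| < η → ∀ r ∈ Metric.ball t η,
        ((h, r) : ℝ × ℝ) ∈ Metric.ball ((0 : ℝ), t) η := by
      intro h hh r hr
      rw [← ball_prod_same]
      exact ⟨by simpa using hh, hr⟩
    have hmv : ∀ h, |h| < η →
        ‖(w (X s + h * (1 + b * (s - t))) s - w (X s) s - h * A * s)
          - (w (X t + h * (1 + b * (t - t))) t - w (X t) t - h * A * t)‖ ≤
          ε * ‖h‖ * ‖s - t‖ := fun h hh =>
      (convex_ball t η).norm_image_sub_le_of_norm_hasDerivWithin_le
        (f := fun s => w (X s + h * (1 + b * (s - t))) s - w (X s) s - h * A * s)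
        (fun r hr => (hball _ (hmem h hh r hr)).1.hasDerivWithinAt)
        (fun r hr => (hball _ (hmem h hh r hr)).2.2) (Metric.mem_ball_self hη) hs
    have hx : ∀ r ∈ Metric.ball t η, ∀ e : ℝ,
        HasDerivAt (fun h => w (X r + h * e) r) (pdx w (X r) r * e) 0 := by
      intro r hr e
      have h₁ := hasDerivAt_pdx (hball _ (hmem 0 (by simpa using hη) r hr)).2.1
      have h₂ : HasDerivAt (fun h => X r + h * e) e 0 := by
        simpa using ((hasDerivAt_id (0 : ℝ)).mul_const e).const_add (X r)
      exact HasDerivAt.comp (h₂ := fun y => w y r) (0 : ℝ) (by simpa using h₁) h₂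
    have hD : HasDerivAt (fun h =>
        (w (X s + h * (1 + b * (s - t))) s - w (X s) s - h * A * s)
          - (w (X t + h * (1 + b * (t - t))) t - w (X t) t - h * A * t))
        ((pdx w (X s) s * (1 + b * (s - t)) - A * s)
          - (pdx w (X t) t * (1 + b * (t - t)) - A * t)) 0 := by
      have hlin : ∀ r : ℝ, HasDerivAt (fun h : ℝ => h * A * r) (A * r) 0 := fun r => by
        simpa using ((hasDerivAt_id (0 : ℝ)).mul_const A).mul_const r
      exact (((hx s hs _).sub_const _).sub (hlin s)).sub
        (((hx t (Metric.mem_ball_self hη) _).sub_const _).sub (hlin t))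
    have := hD.le_of_lip' (C := ε * ‖s - t‖) (by positivity) (by
      filter_upwards [Metric.ball_mem_nhds (0 : ℝ) hη] with h hh
      have h₁ := hmv h (by simpa using hh)
      simp only [zero_mul, add_zero, sub_self, sub_zero] at h₁ ⊢
      linarith)
    convert this using 2
    simp only [sub_self, mul_zero, add_zero, one_mul, smul_eq_mul]
    ring
  have he : HasDerivAt (fun s => 1 + b * (s - t)) b t := by
    simpa using (((hasDerivAt_id t).sub_const t).const_mul b).const_add 1
  have hne : ∀ᶠ s in 𝓝 t, 1 + b * (s - t) ≠ 0 :=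
    he.continuousAt.eventually_ne (by simp)
  have := (hev.div he (by simp)).congr_of_eventuallyEq
    (f₁ := fun s => pdx w (X s) s) (by
      filter_upwards [hne] with s hs
      simp only [Pi.div_apply]
      field_simp)
  refine this.congr_deriv ?_
  rw [sub_self, mul_zero, add_zero]
  ring

/-- The damped Euler system for `γ = 3` in the unknowns `φ = k / τ` and `u`, whose characteristic
speeds are `± φ ^ 2 / k`. -/
structure DampedSol (k : ℝ) (a : ℝ → ℝ) (φ u : ℝ → ℝ → ℝ) : Prop where
  contDiffAt_phi : ∀ x t, 0 ≤ t → ContDiffAt ℝ 1 (fun p : ℝ × ℝ => φ p.1 p.2) (x, t)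
  contDiffAt_u : ∀ x t, 0 ≤ t → ContDiffAt ℝ 1 (fun p : ℝ × ℝ => u p.1 p.2) (x, t)
  pos : ∀ x t, 0 ≤ t → 0 < φ x t
  mass : ∀ x t, 0 ≤ t → pdt φ x t = -(φ x t ^ 2 / k) * pdx u x t
  momentum : ∀ x t, 0 ≤ t → pdt u x t = -(φ x t ^ 2 / k) * pdx φ x t - a t * u x t

theorem pdx_reflect (f : ℝ → ℝ → ℝ) (x t : ℝ) :
    pdx (fun x t => f (-x) t) x t = -pdx f (-x) t :=
  deriv_comp_neg (f := fun y => f y t) (x := x)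

theorem pdx_neg_reflect (f : ℝ → ℝ → ℝ) (x t : ℝ) :
    pdx (fun x t => -f (-x) t) x t = pdx f (-x) t := by
  have h : pdx (fun x t => -f (-x) t) x t = -pdx (fun x t => f (-x) t) x t := by
    simp only [pdx, deriv.fun_neg]
  rw [h, pdx_reflect, neg_neg]

namespace DampedSol

variable {k : ℝ} {a : ℝ → ℝ} {φ u : ℝ → ℝ → ℝ}

theorem reflect (h : DampedSol k a φ u) :
    DampedSol k a (fun x t => φ (-x) t) (fun x t => -u (-x) t) where
  contDiffAt_phi x t ht :=
    (h.contDiffAt_phi (-x) t ht).comp (f := fun p : ℝ × ℝ => (-p.1, p.2)) (x, t) (by fun_prop)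
  contDiffAt_u x t ht :=
    ((h.contDiffAt_u (-x) t ht).comp (f := fun p : ℝ × ℝ => (-p.1, p.2)) (x, t)
      (by fun_prop)).neg
  pos x t ht := h.pos (-x) t ht
  mass x t ht := by
    rw [pdx_neg_reflect]
    exact h.mass (-x) t ht
  momentum x t ht := by
    have h₁ : pdt (fun x t => -u (-x) t) x t = -pdt u (-x) t := by
      simp only [pdt, deriv.fun_neg]
    rw [pdx_reflect, h₁, h.momentum (-x) t ht]
    ring

/-- The Riemann invariants stay bounded. -/
theorem phi_add_abs_lt (h : DampedSol k a φ u) (hk : 0 < k) (ha : ∀ t, 0 < t → 0 ≤ a t) {M : ℝ}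
    (hM : ∀ x, φ x 0 + |u x 0| ≤ M) : ∀ x t, 0 ≤ t → φ x t + |u x t| < M + 2 := by
  have hM0 : 0 ≤ M := (add_nonneg (h.pos 0 0 le_rfl).le (abs_nonneg _)).trans (hM 0)
  have key := neg_of_no_first_touch (G := fun x t => φ x t + |u x t| - (M + 2 - exp (-t)))
    (cs := (M + 2) ^ 2 / k) (by positivity) ?_ ?_ ?_
  · intro x t ht
    have := key x t ht
    have := exp_pos (-t)
    linarith
  · intro x t ht
    have h₁ := (h.contDiffAt_phi x t ht).continuousAt
    have h₂ := (h.contDiffAt_u x t ht).continuousAt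
    fun_prop
  · intro x
    have := hM x
    simp
    linarith
  · intro x t ht hG hbefore
    have hle : φ x t ≤ M + 2 := by
      have := abs_nonneg (u x t)
      have := exp_pos (-t)
      linarith
    have hc0 : 0 ≤ φ x t ^ 2 / k := by positivity
    have hcs : φ x t ^ 2 / k ≤ (M + 2) ^ 2 / k := by
      have := h.pos x t ht.le
      gcongr
    have hline : ∀ v : ℝ, |v| ≤ (M + 2) ^ 2 / k →
        ∀ᶠ s in 𝓝[<] t, φ (x + v * (s - t)) s + |u (x + v * (s - t)) s| < M + 2 - exp (-s) := by
      intro v hv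
      filter_upwards [Ioo_mem_nhdsLT ht] with s hs
      have := hbefore (x + v * (s - t)) s hs.1.le hs.2 (by
        rw [add_sub_cancel_left, abs_mul, abs_sub_comm, abs_of_pos (sub_pos.2 hs.2)]
        exact mul_le_mul_of_nonneg_right hv (sub_pos.2 hs.2).le)
      linarith
    have hX : ∀ v : ℝ, HasDerivAt (fun s => x + v * (s - t)) v t := fun v => by
      simpa using (((hasDerivAt_id t).sub_const t).const_mul v).const_add x
    have hXt : ∀ v : ℝ, x + v * (t - t) = x := fun v => by ring
    have hφ : ∀ v, HasDerivAt (fun s => φ (x + v * (s - t)) s) (pdt φ x t + v * pdx φ x t) t :=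
      fun v => by
        have := hasDerivAt_along (f := φ) (X := fun s => x + v * (s - t))
          (by simpa only [hXt] using h.contDiffAt_phi x t ht.le) (hX v)
        simpa only [hXt] using this
    have hu : ∀ v, HasDerivAt (fun s => u (x + v * (s - t)) s) (pdt u x t + v * pdx u x t) t :=
      fun v => by
        have := hasDerivAt_along (f := u) (X := fun s => x + v * (s - t))
          (by simpa only [hXt] using h.contDiffAt_u x t ht.le) (hX v)
        simpa only [hXt] using this
    have hb : HasDerivAt (fun s => M + 2 - exp (-s)) (exp (-t)) t := by
      simpa using ((hasDerivAt_id t).neg.exp).const_sub (M + 2)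
    have hexp := exp_pos (-t)
    rcases le_total 0 (u x t) with hu0 | hu0
    · have := (((hφ (φ x t ^ 2 / k)).add (hu (φ x t ^ 2 / k))).sub hb).nonneg_of_left
        (by simp only [Pi.sub_apply, Pi.add_apply, hXt]; rw [abs_of_nonneg hu0] at hG; exact hG)
        (by
          filter_upwards [hline (φ x t ^ 2 / k) (by rwa [abs_of_nonneg hc0])] with s hs
          have := le_abs_self (u (x + φ x t ^ 2 / k * (s - t)) s)
          simp only [Pi.sub_apply, Pi.add_apply]
          linarith)
      rw [h.mass x t ht.le, h.momentum x t ht.le] at this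
      have := mul_nonneg (ha t ht) hu0
      linarith
    · have := (((hφ (-(φ x t ^ 2 / k))).sub (hu (-(φ x t ^ 2 / k)))).sub hb).nonneg_of_left
        (by simp only [Pi.sub_apply, hXt]; rw [abs_of_nonpos hu0] at hG; linarith)
        (by
          filter_upwards [hline (-(φ x t ^ 2 / k)) (by rwa [abs_neg, abs_of_nonneg hc0])]
            with s hs
          have := neg_abs_le (u (x + -(φ x t ^ 2 / k) * (s - t)) s)
          simp only [Pi.sub_apply]
          linarith)
      rw [h.mass x t ht.le, h.momentum x t ht.le] at this
      have := mul_nonpos_of_nonneg_of_nonpos (ha t ht) hu0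
      linarith

/-- One-sided bound for the gradient of the Riemann invariant `u + φ`. -/
theorem phi_mul_pdx_add_lt (h : DampedSol k a φ u) (hk : 0 < k)
    (haC : ∀ t, 0 ≤ t → ContDiffAt ℝ 1 a t) (ha' : ∀ t, 0 < t → deriv a t ≤ 0)
    {N : ℝ} (hN : 0 < N) (hφN : ∀ x t, 0 ≤ t → φ x t < N) {F F' : ℝ → ℝ}
    (hF : ∀ t, 0 ≤ t → ContinuousAt F t) (hFd : ∀ t, 0 < t → HasDerivAt F (F' t) t)
    (hF' : ∀ t, 0 < t → k * a t ^ 2 / 16 < F' t)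
    (h0 : ∀ x, φ x 0 * (pdx u x 0 + pdx φ x 0) - a 0 * (k / 2) * log (φ x 0 / N) < F 0) :
    ∀ x t, 0 ≤ t → φ x t * (pdx u x t + pdx φ x t) < F t + a t * (k / 2) * log (φ x t / N) := by
  have key := neg_of_no_first_touch
    (G := fun x t => φ x t * (pdx u x t + pdx φ x t) - a t * (k / 2) * log (φ x t / N) - F t)
    (cs := N ^ 2 / k) (by positivity) ?_ ?_ ?_
  · intro x t ht
    have := key x t ht
    linarith
  · intro x t ht
    have h₁ := (h.contDiffAt_phi x t ht).continuousAt
    have h₂ := continuousAt_pdx (h.contDiffAt_u x t ht)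
    have h₃ := continuousAt_pdx (h.contDiffAt_phi x t ht)
    have h₄ : ContinuousAt (fun p : ℝ × ℝ => a p.2) (x, t) :=
      ContinuousAt.comp (f := fun p : ℝ × ℝ => p.2) (x := (x, t)) (haC t ht).continuousAt
        continuousAt_snd
    have h₅ : ContinuousAt (fun p : ℝ × ℝ => F p.2) (x, t) :=
      ContinuousAt.comp (f := fun p : ℝ × ℝ => p.2) (x := (x, t)) (hF t ht) continuousAt_snd
    have h₆ : ContinuousAt (fun p : ℝ × ℝ => log (φ p.1 p.2 / N)) (x, t) :=
      (h₁.div_const N).log (div_pos (h.pos x t ht) hN).ne'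
    fun_prop
  · intro x
    have := h0 x
    linarith
  · intro x t ht hG hbefore
    have hφC := h.contDiffAt_phi x t ht.le
    have huC := h.contDiffAt_u x t ht.le
    have hφpos := h.pos x t ht.le
    have hcC : ContDiffAt ℝ 1 (fun p : ℝ × ℝ => (fun x t => φ x t ^ 2 / k) p.1 p.2) (x, t) :=
      (hφC.pow 2).div_const k
    have hfC : ContDiffAt ℝ 1 (fun p : ℝ × ℝ => (fun x t => -(a t * u x t)) p.1 p.2) (x, t) :=
      (((haC t ht.le).comp (f := fun p : ℝ × ℝ => p.2) (x, t) contDiffAt_snd).mul huC).neg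
    obtain ⟨X, hXt, hX⟩ := exists_characteristic (c := fun x t => φ x t ^ 2 / k) hcC
    have hpos : ∀ᶠ p : ℝ × ℝ in 𝓝 (x, t), 0 < p.2 :=
      continuousAt_snd.eventually (lt_mem_nhds ht)
    have hpdx : ∀ y s, 0 ≤ s →
        pdx (fun x t => u x t + φ x t) y s = pdx u y s + pdx φ y s := fun y s hs =>
      ((hasDerivAt_pdx (h.contDiffAt_u y s hs)).add
        (hasDerivAt_pdx (h.contDiffAt_phi y s hs))).deriv
    have hpdt : ∀ y s, 0 ≤ s →
        pdt (fun x t => u x t + φ x t) y s = pdt u y s + pdt φ y s := fun y s hs =>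
      ((hasDerivAt_pdt (h.contDiffAt_u y s hs)).add
        (hasDerivAt_pdt (h.contDiffAt_phi y s hs))).deriv
    have hv := hasDerivAt_pdx_along (w := fun x t => u x t + φ x t)
      (c := fun x t => φ x t ^ 2 / k) (f := fun x t => -(a t * u x t)) (X := X) (t := t)
      (by rw [hXt]; exact huC.add hφC) (by rw [hXt]; exact hcC) (by rw [hXt]; exact hfC)
      (by
        rw [hXt]
        filter_upwards [hpos] with p hp
        rw [hpdx _ _ hp.le, hpdt _ _ hp.le, h.mass _ _ hp.le, h.momentum _ _ hp.le]
        ring) hX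
    have hfx : pdx (fun x t => -(a t * u x t)) x t = -(a t * pdx u x t) :=
      ((hasDerivAt_pdx huC).const_mul (a t)).neg.deriv
    have hcx : pdx (fun x t => φ x t ^ 2 / k) x t = 2 * φ x t * pdx φ x t / k := by
      refine ((((hasDerivAt_pdx hφC).pow 2).div_const k).congr_deriv ?_).deriv
      simp
    have hφX := hasDerivAt_along (f := φ) (X := X) (by rw [hXt]; exact hφC) hX.self_of_nhds
    simp only [hXt] at hv hφX
    rw [hpdx x t ht.le, hfx, hcx] at hv
    rw [h.mass x t ht.le] at hφX
    have hlog := (hφX.div_const N).log (by rw [hXt]; exact (div_pos hφpos hN).ne')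
    have had := ((haC t ht.le).differentiableAt one_ne_zero).hasDerivAt
    have hder := (((hφX.mul hv).sub ((had.mul_const (k / 2)).mul hlog)).sub (hFd t ht))
    have hnear : ∀ᶠ s in 𝓝 t, HasDerivAt X (φ (X s) s ^ 2 / k) s ∧ 0 < s :=
      hX.and (lt_mem_nhds ht)
    obtain ⟨η, hη, hball⟩ := Metric.eventually_nhds_iff_ball.1 hnear
    have hcone : ∀ s ∈ Metric.ball t η, |X s - x| ≤ N ^ 2 / k * |s - t| := by
      intro s hs
      have := (convex_ball t η).norm_image_sub_le_of_norm_hasDerivWithin_le (C := N ^ 2 / k)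
        (fun r hr => (hball r hr).1.hasDerivWithinAt) (fun r hr => by
          have h₁ := h.pos (X r) r (hball r hr).2.le
          have h₂ := hφN (X r) r (hball r hr).2.le
          rw [norm_of_nonneg (by positivity)]
          gcongr) (Metric.mem_ball_self hη) hs
      rwa [hXt] at this
    have hge := hder.nonneg_of_left
      (by
        simp only [Pi.sub_apply, Pi.mul_apply, hXt, hpdx x t ht.le]
        exact hG)
      (by
        filter_upwards [nhdsWithin_le_nhds (Metric.ball_mem_nhds t hη), self_mem_nhdsWithin]
          with s hs hst
        have hs0 := (hball s hs).2.le
        have hst : s < t := hst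
        have h₁ := hcone s hs
        rw [abs_sub_comm s t, abs_of_pos (sub_pos.2 hst)] at h₁
        have := hbefore (X s) s hs0 hst h₁
        simp only [Pi.sub_apply, Pi.mul_apply, hpdx _ _ hs0]
        exact this.le)
    have hL : log (φ x t / N) ≤ 0 :=
      log_nonpos (div_pos hφpos hN).le ((div_le_one hN).2 (hφN x t ht.le).le)
    have h₁ := mul_nonneg_of_nonpos_of_nonpos (ha' t ht) hL
    have h₂ := hF' t ht
    rw [hXt] at hge
    have hid : ∀ p q A A' L D f : ℝ, f ≠ 0 →
        (-(f ^ 2 / k) * q + f ^ 2 / k * p) * (q + p)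
          + f * (-(A * q) - 2 * f * p / k * (q + p))
          - (A' * (k / 2) * L + A * (k / 2) * ((-(f ^ 2 / k) * q + f ^ 2 / k * p) / N / (f / N)))
          - D
        = -((f * (q + p) + A * k / 4) ^ 2 / k) + k * A ^ 2 / 16 - k / 2 * (A' * L) - D := by
      intro p q A A' L D f hf
      field_simp
      ring
    rw [hpdx x t ht.le, hid _ _ _ _ _ _ _ hφpos.ne'] at hge
    have h₃ : 0 ≤ (φ x t * (pdx u x t + pdx φ x t) + a t * k / 4) ^ 2 / k := by positivity
    have h₄ : 0 ≤ k / 2 * (deriv a t * log (φ x t / N)) := by positivity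
    linarith

/-- Exponential lower bound for `φ`, given a barrier `F` growing at most like `1 + a t`. -/
theorem mul_exp_le_phi (h : DampedSol k a φ u) (hk : 0 < k)
    (haC : ∀ t, 0 ≤ t → ContDiffAt ℝ 1 a t) (ha : ∀ t, 0 ≤ t → 0 ≤ a t)
    (ha' : ∀ t, 0 < t → deriv a t ≤ 0)
    {N : ℝ} (hN : 0 < N) (hφN : ∀ x t, 0 ≤ t → φ x t < N) {F F' : ℝ → ℝ}
    (hF : ∀ t, 0 ≤ t → ContinuousAt F t) (hFd : ∀ t, 0 < t → HasDerivAt F (F' t) t)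
    (hF' : ∀ t, 0 < t → k * a t ^ 2 / 16 < F' t)
    (h0 : ∀ x, φ x 0 * (|pdx u x 0| + |pdx φ x 0|) - a 0 * (k / 2) * log (φ x 0 / N) < F 0)
    {m R : ℝ} (hm : 0 < m) (hφm : ∀ x, m ≤ φ x 0)
    (hFR : ∀ t, 0 ≤ t → F t ≤ k * R * (1 + a t * t / 2)) :
    ∀ x t, 0 ≤ t → m * exp (-R * t) ≤ φ x t := by
  intro x t ht
  have hplus := h.phi_mul_pdx_add_lt hk haC ha' hN hφN hF hFd hF' (fun y => by
    refine lt_of_le_of_lt ?_ (h0 y)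
    have := (h.pos y 0 le_rfl).le
    gcongr <;> exact le_abs_self _) x
  have hminus := h.reflect.phi_mul_pdx_add_lt hk haC ha' hN (fun y => hφN (-y)) hF hFd hF'
    (fun y => by
      rw [pdx_reflect, pdx_neg_reflect]
      refine lt_of_le_of_lt ?_ (h0 (-y))
      have := (h.pos (-y) 0 le_rfl).le
      gcongr
      · exact le_abs_self _
      · exact neg_le_abs _) (-x)
  simp only [pdx_reflect, pdx_neg_reflect, neg_neg] at hminus
  have hux : ∀ s, 0 ≤ s → φ x s * pdx u x s < F s + a s * (k / 2) * log (φ x s / N) := by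
    intro s hs
    have h₁ := hplus s hs
    have h₂ := hminus s hs
    linarith
  have hd : ∀ s, 0 ≤ s →
      HasDerivAt (fun s => -log (φ x s / N)) (φ x s * pdx u x s / k) s := by
    intro s hs
    have hp := h.pos x s hs
    refine ((((hasDerivAt_pdt (h.contDiffAt_phi x s hs)).div_const N).log
      (div_pos hp hN).ne').neg).congr_deriv ?_
    rw [h.mass x s hs]
    field_simp
  have hmN : log (m / N) ≤ 0 := log_nonpos (by positivity)
    ((div_le_one hN).2 ((hφm x).trans (hφN x 0 le_rfl).le))
  have := image_le_of_deriv_right_lt_deriv_boundary (a := 0) (b := t)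
    (B := fun s => -log (m / N) + R * s) (B' := fun _ => R)
    (fun s hs => (hd s hs.1).continuousAt.continuousWithinAt)
    (fun s hs => (hd s hs.1).hasDerivWithinAt)
    (by
      have := hφm x
      have : log (m / N) ≤ log (φ x 0 / N) := by gcongr
      simpa using this)
    (fun s => by simpa using ((hasDerivAt_id s).const_mul R).const_add (-log (m / N)))
    (fun s hs heq => by
      have h₁ := hux s hs.1
      have h₂ := hFR s hs.1
      have h₃ : log (φ x s / N) = log (m / N) - R * s := by
        linarith
      rw [h₃] at h₁
      rw [div_lt_iff₀ hk]
      have h₄ := mul_nonpos_of_nonneg_of_nonpos (mul_nonneg (ha s hs.1) hk.le) hmN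
      linarith)
    (right_mem_Icc.2 ht)
  have hp := h.pos x t ht
  rw [log_div hm.ne' hN.ne', log_div hp.ne' hN.ne'] at this
  rw [← log_le_log_iff (by positivity) hp, log_mul hm.ne' (exp_pos _).ne', log_exp]
  linarith

end DampedSol

theorem hasDerivAt_const_div {τ : ℝ → ℝ} {k τ' x : ℝ} (h : HasDerivAt τ τ' x) (h0 : τ x ≠ 0) :
    HasDerivAt (fun y => k / τ y) (-(k * τ' / τ x ^ 2)) x :=
  ((hasDerivAt_const x k).div h h0).congr_deriv (by ring)

theorem IsSol.dampedSol {K α lam : ℝ} (hK : 0 < K) {τ u : ℝ → ℝ → ℝ} (h : IsSol K 3 α lam τ u) :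
    DampedSol √(3 * K) (fun t => α / (1 + t) ^ lam) (fun x t => √(3 * K) / τ x t) u := by
  obtain ⟨hτC, huC, hpos, hmass, hmom⟩ := h
  have hk : 0 < √(3 * K) := by positivity
  have hk2 : √(3 * K) ^ 2 = 3 * K := sq_sqrt (by positivity)
  have hτx : ∀ x t, HasDerivAt (fun y => τ y t) (pdx τ x t) x := fun x t =>
    hasDerivAt_pdx hτC.contDiffAt
  have hτt : ∀ x t, HasDerivAt (fun s => τ x s) (pdt τ x t) t := fun x t =>
    hasDerivAt_pdt hτC.contDiffAt
  refine ⟨fun x t ht => ?_, fun x t _ => huC.contDiffAt, fun x t ht => ?_, fun x t ht => ?_,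
    fun x t ht => ?_⟩
  · exact contDiffAt_const.div hτC.contDiffAt (hpos x t ht).ne'
  · exact div_pos hk (hpos x t ht)
  · have hp := hpos x t ht
    have h₁ : pdt (fun x t => √(3 * K) / τ x t) x t = _ :=
      (hasDerivAt_const_div (hτt x t) hp.ne').deriv
    rw [h₁, hmass x t ht]
    field_simp
  · have hp := hpos x t ht
    have h₁ : pdx (fun x t => √(3 * K) / τ x t) x t = _ :=
      (hasDerivAt_const_div (hτx x t) hp.ne').deriv
    have h₂ : pdx (fun y s => K * τ y s ^ (-3 : ℝ)) x t = -(3 * K * pdx τ x t / τ x t ^ 4) := by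
      refine ((((hτx x t).rpow_const (p := (-3 : ℝ)) (Or.inl hp.ne')).const_mul K).congr_deriv
        ?_).deriv
      rw [show (-3 - 1 : ℝ) = -(4 : ℕ) by norm_num, rpow_neg hp.le, rpow_natCast]
      field_simp
    have h₃ := hmom x t ht
    rw [h₂] at h₃
    rw [h₁, ← sub_eq_zero]
    have h₄ : -((√(3 * K) / τ x t) ^ 2 / √(3 * K)) * -(√(3 * K) * pdx τ x t / τ x t ^ 2)
        = √(3 * K) ^ 2 * pdx τ x t / τ x t ^ 4 := by
      field_simp
    rw [h₄, hk2]
    linarith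

theorem hasDerivAt_damping (α lam : ℝ) {t : ℝ} (ht : 0 ≤ t) :
    HasDerivAt (fun t => α / (1 + t) ^ lam) (-(α * lam * (1 + t) ^ (-lam - 1))) t := by
  have hs : 0 < 1 + t := by linarith
  have h := ((((hasDerivAt_id t).const_add 1).rpow_const (p := -lam)
    (Or.inl hs.ne')).const_mul α).congr_deriv
    (show _ = -(α * lam * (1 + t) ^ (-lam - 1)) by simp; ring)
  refine h.congr_of_eventuallyEq ?_
  filter_upwards [lt_mem_nhds (show -1 < t by linarith)] with s hs
  simp only [id]
  rw [rpow_neg (by linarith), div_eq_mul_inv]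

theorem contDiffAt_damping (α lam : ℝ) {t : ℝ} (ht : 0 ≤ t) :
    ContDiffAt ℝ 1 (fun t => α / (1 + t) ^ lam) t := by
  have hs : 0 < 1 + t := by linarith
  exact contDiffAt_const.div ((contDiffAt_const.add contDiffAt_id).rpow_const_of_ne hs.ne')
    (rpow_pos_of_pos hs lam).ne'

/-- A strict antiderivative bound for the squared damping coefficient `a`, growing at most like
`1 + a t`. -/
theorem exists_damping_barrier {α lam : ℝ} (hα : 0 ≤ α) (hlam : 0 ≤ lam) :
    ∃ (H H' : ℝ → ℝ) (B : ℝ), 0 ≤ B ∧ (∀ t, 0 ≤ t → HasDerivAt H (H' t) t) ∧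
      (∀ t, 0 ≤ t → (α / (1 + t) ^ lam) ^ 2 < H' t) ∧
      ∀ t, 0 ≤ t → H t ≤ B * (1 + α / (1 + t) ^ lam * t) := by
  have hinv : ∀ t : ℝ, 0 ≤ t → HasDerivAt (fun t => (1 + t)⁻¹) (-((1 + t) ^ 2)⁻¹) t := by
    intro t ht
    exact (((hasDerivAt_id t).const_add 1).fun_inv (by simp only [id]; positivity)).congr_deriv
      (by simp [div_eq_mul_inv])
  rcases lt_or_ge lam 1 with hl | hl
  · have hl' : 0 < 1 - lam := by linarith
    refine ⟨fun t => α ^ 2 / (1 - lam) * (1 + t) ^ (1 - lam) - (1 + t)⁻¹,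
      fun t => α ^ 2 * (1 + t) ^ (-lam) + ((1 + t) ^ 2)⁻¹, α * (α + 1) / (1 - lam),
      by positivity, fun t ht => ?_, fun t ht => ?_, fun t ht => ?_⟩
    · have hs : 0 < 1 + t := by linarith
      have h := ((((hasDerivAt_id t).const_add 1).rpow_const (p := 1 - lam)
        (Or.inl hs.ne')).const_mul (α ^ 2 / (1 - lam))).sub (hinv t ht)
      refine h.congr_deriv ?_
      rw [show 1 - lam - 1 = -lam by ring]
      simp only [id]
      field_simp
      ring
    · have hs : 1 ≤ 1 + t := by linarith
      have h₁ : 1 ≤ (1 + t) ^ lam := one_le_rpow hs hlam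
      have h₂ : 0 < ((1 + t) ^ 2)⁻¹ := by positivity
      have h₃ : (α / (1 + t) ^ lam) ^ 2 ≤ α ^ 2 * (1 + t) ^ (-lam) := by
        rw [rpow_neg (by linarith), div_pow, div_eq_mul_inv]
        gcongr
        nlinarith
      linarith
    · have hs : 1 ≤ 1 + t := by linarith
      have h₁ : 1 ≤ (1 + t) ^ lam := one_le_rpow hs hlam
      have h₂ : 0 < (1 + t)⁻¹ := by positivity
      have h₃ : α / (1 + t) ^ lam ≤ α := div_le_self hα h₁
      have h₄ : 0 ≤ α / (1 + t) ^ lam := by positivity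
      have h₅ : α ^ 2 / (1 - lam) * (1 + t) ^ (1 - lam)
          = α / (1 - lam) * (α / (1 + t) ^ lam * (1 + t)) := by
        rw [rpow_sub (by linarith), rpow_one]
        ring
      have h₆ : α * (α + 1) / (1 - lam) * (1 + α / (1 + t) ^ lam * t)
          = α / (1 - lam) * ((α + 1) * (1 + α / (1 + t) ^ lam * t)) := by ring
      simp only
      rw [h₅, h₆]
      have h₇ : α / (1 + t) ^ lam * (1 + t) ≤ (α + 1) * (1 + α / (1 + t) ^ lam * t) := by
        have := mul_nonneg h₄ ht
        nlinarith
      have := mul_le_mul_of_nonneg_left h₇ (show 0 ≤ α / (1 - lam) by positivity)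
      linarith
  · refine ⟨fun t => -((α ^ 2 + 1) * (1 + t)⁻¹), fun t => (α ^ 2 + 1) * ((1 + t) ^ 2)⁻¹, 0, le_rfl,
      fun t ht => ?_, fun t ht => ?_, fun t ht => ?_⟩
    · exact ((hinv t ht).const_mul (α ^ 2 + 1)).neg.congr_deriv (by ring)
    · have hs : 1 ≤ 1 + t := by linarith
      have h₁ : 1 + t ≤ (1 + t) ^ lam := by
        simpa using rpow_le_rpow_of_exponent_le hs hl
      calc (α / (1 + t) ^ lam) ^ 2 ≤ (α / (1 + t)) ^ 2 := by gcongr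
        _ < (α ^ 2 + 1) * ((1 + t) ^ 2)⁻¹ := by
          rw [div_pow, div_eq_mul_inv]
          gcongr
          linarith
    · rw [zero_mul]
      exact neg_nonpos.2 (by positivity)

theorem stmt6 (K γ α lam C₀ : ℝ) (hK : 0 < K) (hγ : γ = 3)
    (hα : 0 ≤ α) (hlam : 0 ≤ lam) (hC₀ : 0 < C₀) :
    ∃ Mhat > (0 : ℝ),
      ∀ (τ₀ u₀ : ℝ → ℝ), ContDiff ℝ 1 τ₀ → ContDiff ℝ 1 u₀ →
        (∀ x, |u₀ x| ≤ C₀ ∧ |deriv u₀ x| ≤ C₀) →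
        (∀ x, |τ₀ x| ≤ C₀ ∧ |deriv τ₀ x| ≤ C₀) →
        (∀ x, C₀⁻¹ < τ₀ x) →
      ∀ (τ u : ℝ → ℝ → ℝ), IsSol K γ α lam τ u →
        (∀ x, τ x 0 = τ₀ x ∧ u x 0 = u₀ x) →
        (∃ U : ℝ, ∀ x t, 0 ≤ t → |u x t| ≤ U) ∧
        (∀ x t, 0 ≤ t → C₀⁻¹ * Real.exp (-Mhat * t) ≤ (τ x t)⁻¹) := by
  subst hγ
  obtain ⟨H, H', B, hB, hHd, hH', hHB⟩ := exists_damping_barrier hα hlam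
  set k := √(3 * K) with hkdef
  have hk : 0 < k := by positivity
  set N := k * C₀ + C₀ + 2 with hNdef
  have hN : 0 < N := by positivity
  set F₀ := k * C₀ * (C₀ + k * C₀ ^ 3) + α * (k / 2) * log (N * C₀ / k) - k / 16 * H 0 + 1
    with hF₀
  set R := (|F₀| + k * B / 8 + 1) / k with hRdef
  have hkR : k * R = |F₀| + k * B / 8 + 1 := by
    rw [hRdef]; field_simp
  refine ⟨R, by positivity, fun τ₀ u₀ _ _ hu₀ hτ₀ hτ₀low τ u hsol hinit => ?_⟩
  have hD := hsol.dampedSol hK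
  rw [← hkdef] at hD
  have ha : ∀ t : ℝ, 0 ≤ t → 0 ≤ α / (1 + t) ^ lam := fun t ht => by positivity
  have hτpos : ∀ x, 0 < τ₀ x := fun x => (inv_pos.2 hC₀).trans (hτ₀low x)
  have hinvτ : ∀ x, (τ₀ x)⁻¹ ≤ C₀ := fun x => inv_le_of_inv_le₀ hC₀ (hτ₀low x).le
  have hφ₀ : ∀ x, k / τ x 0 ≤ k * C₀ := fun x => by
    rw [(hinit x).1, div_eq_mul_inv]
    exact mul_le_mul_of_nonneg_left (hinvτ x) hk.le
  have hφm : ∀ x, k / C₀ ≤ k / τ x 0 := fun x => by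
    rw [(hinit x).1]
    have := hτpos x
    gcongr
    exact (le_abs_self _).trans (hτ₀ x).1
  have hbound := hD.phi_add_abs_lt hk (fun t ht => ha t ht.le) (M := k * C₀ + C₀) (fun x => by
    have := (hu₀ x).1
    rw [← (hinit x).2] at this
    exact add_le_add (hφ₀ x) this)
  rw [← hNdef] at hbound
  refine ⟨⟨N, fun x t ht => ?_⟩, fun x t ht => ?_⟩
  · have h₁ := hbound x t ht
    have h₂ := hD.pos x t ht
    linarith
  have h0 : ∀ x, k / τ x 0 * (|pdx u x 0| + |pdx (fun x t => k / τ x t) x 0|)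
      - α / (1 + 0) ^ lam * (k / 2) * log (k / τ x 0 / N) < F₀ + k / 16 * H 0 := by
    intro x
    have hux : pdx u x 0 = deriv u₀ x := by
      simp only [pdx, (hinit _).2]
    have hτx : pdx τ x 0 = deriv τ₀ x := by
      simp only [pdx, (hinit _).1]
    have hφx : pdx (fun x t => k / τ x t) x 0 = -(k * pdx τ x 0 / τ x 0 ^ 2) :=
      (hasDerivAt_const_div (hasDerivAt_pdx hsol.1.contDiffAt)
        (hsol.2.2.1 x 0 le_rfl).ne').deriv
    have h₁ : |pdx (fun x t => k / τ x t) x 0| ≤ k * C₀ ^ 3 := by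
      rw [hφx, hτx, (hinit x).1, abs_neg, abs_div, abs_mul, abs_of_pos hk,
        abs_of_pos (pow_pos (hτpos x) 2), div_eq_mul_inv, ← inv_pow]
      have := hinvτ x
      have := hτpos x
      calc k * |deriv τ₀ x| * (τ₀ x)⁻¹ ^ 2 ≤ k * C₀ * C₀ ^ 2 := by
            gcongr
            exact (hτ₀ x).2
        _ = k * C₀ ^ 3 := by ring
    have h₂ : |pdx u x 0| ≤ C₀ := hux ▸ (hu₀ x).2
    have h₃ : k / τ x 0 * (|pdx u x 0| + |pdx (fun x t => k / τ x t) x 0|)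
        ≤ k * C₀ * (C₀ + k * C₀ ^ 3) := by
      have := hφ₀ x
      gcongr
    have h₄ : -log (k / τ x 0 / N) ≤ log (N * C₀ / k) := by
      rw [← log_inv]
      have hp := hD.pos x 0 le_rfl
      refine log_le_log (by positivity) ?_
      rw [inv_div, show N * C₀ / k = N / (k / C₀) by field_simp]
      exact div_le_div_of_nonneg_left hN.le (by positivity) (hφm x)
    have h₅ : α * (k / 2) * -log (k / τ x 0 / N) ≤ α * (k / 2) * log (N * C₀ / k) :=
      mul_le_mul_of_nonneg_left h₄ (by positivity)
    rw [add_zero, one_rpow, div_one]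
    linarith
  have hlow := hD.mul_exp_le_phi hk (fun t ht => contDiffAt_damping α lam ht) ha
    (fun t ht => by
      rw [(hasDerivAt_damping α lam ht.le).deriv]
      exact neg_nonpos.2 (by positivity))
    hN (fun y s hs => (le_add_of_nonneg_right (abs_nonneg _)).trans_lt (hbound y s hs))
    (F := fun t => F₀ + k / 16 * H t) (F' := fun t => k / 16 * H' t)
    (fun t ht => (((hHd t ht).const_mul (k / 16)).const_add F₀).continuousAt)
    (fun t ht => ((hHd t ht.le).const_mul (k / 16)).const_add F₀)
    (fun t ht => by
      have := mul_lt_mul_of_pos_left (hH' t ht.le) (show 0 < k / 16 by positivity)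
      linarith)
    h0 (m := k / C₀) (by positivity) hφm (R := R)
    (fun t ht => by
      have h₁ := mul_le_mul_of_nonneg_left (hHB t ht) (show 0 ≤ k / 16 by positivity)
      have h₂ := mul_nonneg (ha t ht) ht
      have h₃ := le_abs_self F₀
      have h₄ := mul_nonneg (abs_nonneg F₀) h₂
      have h₅ := mul_nonneg hk.le hB
      rw [hkR]
      linarith)
    x t ht
  have h₁ : C₀⁻¹ * exp (-R * t) = k / C₀ * exp (-R * t) / k := by field_simp
  have h₂ : (τ x t)⁻¹ = k / τ x t / k := by field_simp
  rw [h₁, h₂]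
  exact div_le_div_of_nonneg_right hlow hk.le
end

section
/- Let 1 < γ < 3, λ ≥ 0 with λ ≠ 1, α ≥ 0, K > 0, M > 0, and let τ : [0,∞) → (0,∞) be a differentiable function satisfying (Kγ)^{1/4} τ(t)^{−(γ+1)/4} τ′(t) + (α/(1+t)^λ) · (4(Kγ)^{1/4}/(3−γ)) τ(t)^{(3−γ)/4} ≤ M for all t ≥ 0. Then for all t ≥ 0, τ(t)^{(3−γ)/4} ≤ e^{α(1 − (1+t)^{1−λ})/(1−λ)} τ(0)^{(3−γ)/4} + ((3−γ)/4)(Kγ)^{−1/4} M t; in particular, τ(t)^{−1} ≥ (τ(0)^{(3−γ)/4} + ((3−γ)/4)(Kγ)^{−1/4} M t)^{4/(γ−3)}. -/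
open Real Set

/-- A function on `[0, ∞)` with nonpositive derivative is bounded by its initial value. -/
lemma le_initial_of_hasDerivAt_nonpos {g g' : ℝ → ℝ}
    (hg : ∀ s, 0 ≤ s → HasDerivAt g (g' s) s) (hg' : ∀ s, 0 ≤ s → g' s ≤ 0)
    {t : ℝ} (ht : 0 ≤ t) : g t ≤ g 0 := by
  have hanti : AntitoneOn g (Ici 0) :=
    antitoneOn_of_hasDerivWithinAt_nonpos (f' := g') (convex_Ici 0)
      (fun s hs => (hg s hs).continuousAt.continuousWithinAt)
      (fun s hs => (hg s (interior_subset hs)).hasDerivWithinAt)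
      (fun s hs => hg' s (interior_subset hs))
  exact hanti self_mem_Ici ht ht

/-- Gronwall-type estimate for `y' + a y ≤ N`, where `A` is a primitive of `a ≥ 0`. -/
lemma le_exp_mul_add_of_deriv_add_mul_le {y y' A a : ℝ → ℝ} {N : ℝ} (hN : 0 ≤ N)
    (hy : ∀ s, 0 ≤ s → HasDerivAt y (y' s) s) (hA : ∀ s, 0 ≤ s → HasDerivAt A (a s) s)
    (ha : ∀ s, 0 ≤ s → 0 ≤ a s) (hA0 : A 0 = 0)
    (h : ∀ s, 0 ≤ s → y' s + a s * y s ≤ N) {t : ℝ} (ht : 0 ≤ t) :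
    y t ≤ exp (-A t) * y 0 + N * t := by
  have hg : ∀ s, 0 ≤ s → HasDerivAt (fun s => exp (A s) * (y s - N * s))
      (exp (A s) * a s * (y s - N * s) + exp (A s) * (y' s - N * 1)) s := fun s hs =>
    (hA s hs).exp.mul ((hy s hs).sub ((hasDerivAt_id s).const_mul N))
  have key := le_initial_of_hasDerivAt_nonpos hg (fun s hs => by
    have h1 : 0 ≤ a s * (N * s) := mul_nonneg (ha s hs) (mul_nonneg hN hs)
    have h2 : exp (A s) * (y' s + a s * y s - N - a s * (N * s)) ≤ 0 :=
      mul_nonpos_of_nonneg_of_nonpos (exp_pos _).le (by linarith [h s hs])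
    linarith) ht
  simp only [hA0, exp_zero, mul_zero, sub_zero, one_mul] at key
  have h3 := mul_le_mul_of_nonneg_left key (exp_pos (-A t)).le
  rw [← mul_assoc, ← exp_add, neg_add_cancel, exp_zero, one_mul] at h3
  linarith

/-- A primitive of `α / (1 + t) ^ lam` for `lam ≠ 1`. -/
lemma hasDerivAt_damping_primitive (α : ℝ) {lam s : ℝ} (hlam : lam ≠ 1) (hs : 0 ≤ s) :
    HasDerivAt (fun t : ℝ => α * ((1 + t) ^ (1 - lam) - 1) / (1 - lam))
      (α / (1 + s) ^ lam) s := by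
  have h1 : (1 + s) ≠ 0 := by positivity
  have hl : 1 - lam ≠ 0 := sub_ne_zero.mpr hlam.symm
  have h := (((((hasDerivAt_id s).const_add 1).rpow_const (p := 1 - lam)
    (Or.inl h1)).sub_const 1).const_mul α).div_const (1 - lam)
  refine h.congr_deriv ?_
  rw [show 1 - lam - 1 = -lam by ring, id, rpow_neg (by positivity)]
  field_simp

theorem stmt16 (K γ α lam M : ℝ) (hK : 0 < K) (hγ1 : 1 < γ) (hγ3 : γ < 3)
    (hlam0 : 0 ≤ lam) (hlam1 : lam ≠ 1) (hα : 0 ≤ α) (hM : 0 < M)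
    (τ τ' : ℝ → ℝ) (hpos : ∀ t, 0 ≤ t → 0 < τ t)
    (hderiv : ∀ t, 0 ≤ t → HasDerivAt τ (τ' t) t)
    (hineq : ∀ t, 0 ≤ t →
      (K * γ) ^ ((1 : ℝ) / 4) * τ t ^ (-(γ + 1) / 4) * τ' t +
          α / (1 + t) ^ lam * (4 * (K * γ) ^ ((1 : ℝ) / 4) / (3 - γ)) * τ t ^ ((3 - γ) / 4)
        ≤ M) :
    ∀ t, 0 ≤ t →
      τ t ^ ((3 - γ) / 4) ≤
          Real.exp (α * (1 - (1 + t) ^ (1 - lam)) / (1 - lam)) * τ 0 ^ ((3 - γ) / 4) +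
            (3 - γ) / 4 * (K * γ) ^ (-(1 : ℝ) / 4) * M * t ∧
      (τ 0 ^ ((3 - γ) / 4) + (3 - γ) / 4 * (K * γ) ^ (-(1 : ℝ) / 4) * M * t) ^
          ((4 : ℝ) / (γ - 3)) ≤ (τ t)⁻¹ := by
  intro t ht
  have h3γ : 0 < 3 - γ := by linarith
  have hKγ : 0 < K * γ := by positivity
  have hN : 0 ≤ (3 - γ) / 4 * (K * γ) ^ (-(1 : ℝ) / 4) * M := by positivity
  have ha : ∀ s : ℝ, 0 ≤ s → 0 ≤ α / (1 + s) ^ lam := fun s hs => by positivity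
  have hy : ∀ s, 0 ≤ s → HasDerivAt (fun s => τ s ^ ((3 - γ) / 4))
      ((3 - γ) / 4 * τ s ^ (-(γ + 1) / 4) * τ' s) s := fun s hs => by
    refine ((hderiv s hs).rpow_const (p := (3 - γ) / 4)
      (Or.inl (hpos s hs).ne')).congr_deriv ?_
    rw [show (3 - γ) / 4 - 1 = -(γ + 1) / 4 by ring]
    ring
  have hle : ∀ s, 0 ≤ s → (3 - γ) / 4 * τ s ^ (-(γ + 1) / 4) * τ' s
      + α / (1 + s) ^ lam * τ s ^ ((3 - γ) / 4)
      ≤ (3 - γ) / 4 * (K * γ) ^ (-(1 : ℝ) / 4) * M := fun s hs => by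
    have hC : 0 < (K * γ) ^ ((1 : ℝ) / 4) := by positivity
    have hm := mul_le_mul_of_nonneg_left (hineq s hs)
      (by positivity : 0 ≤ (3 - γ) / 4 * (K * γ) ^ (-(1 : ℝ) / 4))
    refine le_of_eq_of_le ?_ hm
    rw [neg_div 4 (1 : ℝ), rpow_neg hKγ.le]
    generalize α / (1 + s) ^ lam = a, τ s ^ (-(γ + 1) / 4) = u, τ s ^ ((3 - γ) / 4) = v
    generalize (K * γ) ^ ((1 : ℝ) / 4) = C at hC ⊢
    field_simp
  constructor
  · have h := le_exp_mul_add_of_deriv_add_mul_le hN hy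
      (fun s hs => hasDerivAt_damping_primitive α hlam1 hs) ha (by simp) hle ht
    convert h using 4
    ring
  · have h := le_exp_mul_add_of_deriv_add_mul_le (A := fun _ => 0) (a := fun _ => 0) hN hy
      (fun s _ => hasDerivAt_const s 0) (fun _ _ => le_rfl) rfl (fun s hs => by
        have := mul_nonneg (ha s hs) (rpow_nonneg (hpos s hs).le ((3 - γ) / 4))
        linarith [hle s hs]) ht
    simp only [neg_zero, exp_zero, one_mul] at h
    have hτ := hpos t ht
    refine (rpow_le_rpow_of_nonpos (rpow_pos_of_pos hτ _) h
      (div_nonpos_of_nonneg_of_nonpos (by norm_num) (by linarith))).trans_eq ?_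
    have hne : γ - 3 ≠ 0 := (sub_neg.mpr hγ3).ne
    rw [← rpow_mul hτ.le, show (3 - γ) / 4 * (4 / (γ - 3)) = -1 by field_simp; ring, rpow_neg_one]
end
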